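/- (Discrete convolution of multipliers with truncation error) If |r^i| ≤ C i^{-min(α+1, 2-α)} for 1 ≤ i ≤ N, then Σ_{i=1}^{n} |r^i| θ_{n-i} ≤ C' τ t_n^{α-1} for 1 ≤ n ≤ N, where θ_k are the L1 multipliers, t_n = nτ, and C' depends only on C, α, T. -/

import Mathlib

open Finset

lemma aux_logconvex (p : ℝ) (hp0 : 0 < p) (hp1 : p < 1) (a : ℕ → ℝ)
    (ha : ∀ i : ℕ, a i = ((i : ℝ) + 1) ^ p - (i : ℝ) ^ p) (hpos : ∀ i, 0 < a i) (i : ℕ) :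
    a (i + 1) * a (i + 1) ≤ a i * a (i + 2) := by
  have key : ∀ x y : ℝ, 0 ≤ x ^ 2 * a i - 2 * (x * y) * a (i + 1) + y ^ 2 * a (i + 2) := by
    intro x y
    let g : ℝ → ℝ := fun s => x ^ 2 * (i + s) ^ p - 2 * (x * y) * (i + 1 + s) ^ p
      + y ^ 2 * (i + 2 + s) ^ p
    have hi : (0 : ℝ) ≤ i := Nat.cast_nonneg i
    have hmono : MonotoneOn g (Set.Icc 0 1) := by
      have hd : ∀ s : ℝ, 0 < s → HasDerivAt g (x ^ 2 * (1 * p * (i + s) ^ (p - 1))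
          - 2 * (x * y) * (1 * p * (i + 1 + s) ^ (p - 1))
          + y ^ 2 * (1 * p * (i + 2 + s) ^ (p - 1))) s := by
        intro s hs
        have h1 := ((hasDerivAt_id s).const_add (i : ℝ)).rpow_const (p := p)
          (Or.inl (by simp only [id]; positivity))
        have h2 := ((hasDerivAt_id s).const_add (i + 1 : ℝ)).rpow_const (p := p)
          (Or.inl (by simp only [id]; positivity))
        have h3 := ((hasDerivAt_id s).const_add (i + 2 : ℝ)).rpow_const (p := p)
          (Or.inl (by simp only [id]; positivity))
        exact ((h1.const_mul (x ^ 2)).sub (h2.const_mul (2 * (x * y)))).add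
          (h3.const_mul (y ^ 2))
      apply monotoneOn_of_deriv_nonneg (convex_Icc 0 1)
      · have hc : ∀ c : ℝ, Continuous fun s : ℝ => (c + s) ^ p := fun c =>
          (continuous_const.add continuous_id).rpow_const (fun _ => Or.inr hp0.le)
        exact (((continuous_const.mul (hc _)).sub (continuous_const.mul (hc _))).add
          (continuous_const.mul (hc _))).continuousOn
      · intro s hs
        rw [interior_Icc] at hs
        exact (hd s hs.1).differentiableAt.differentiableWithinAt
      · intro s hs
        rw [interior_Icc] at hs
        rw [(hd s hs.1).deriv]
        have hs0 := hs.1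
        set q := (p - 1) / 2 with hq
        have sq : ∀ c : ℝ, 0 < c → c ^ (p - 1) = (c ^ q) ^ 2 := by
          intro c hc
          rw [← Real.rpow_natCast, ← Real.rpow_mul hc.le]
          congr 1; rw [hq]; push_cast; ring
        have hu : (0 : ℝ) < i + s := by positivity
        have hv : (0 : ℝ) < i + 1 + s := by positivity
        have hw : (0 : ℝ) < i + 2 + s := by positivity
        rw [sq _ hu, sq _ hw]
        have hm : ((i : ℝ) + 1 + s) ^ (p - 1) ≤ (i + s) ^ q * (i + 2 + s) ^ q := by
          rw [sq _ hv, ← Real.mul_rpow hu.le hw.le, ← Real.rpow_natCast, ← Real.rpow_mul hv.le,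
            mul_comm q, Real.rpow_mul hv.le]
          apply Real.rpow_le_rpow_of_nonpos (by positivity)
          · rw [Real.rpow_natCast]; nlinarith
          · rw [hq]; linarith
        have hM := Real.rpow_nonneg hv.le (p - 1)
        generalize ((i : ℝ) + s) ^ q = U at *
        generalize ((i : ℝ) + 2 + s) ^ q = W at *
        generalize ((i : ℝ) + 1 + s) ^ (p - 1) = M at *
        have : 0 ≤ x ^ 2 * U ^ 2 - 2 * (x * y) * M + y ^ 2 * W ^ 2 := by
          rcases le_total 0 (x * y) with h | h
          · nlinarith [sq_nonneg (x * U - y * W), mul_le_mul_of_nonneg_left hm h]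
          · nlinarith [mul_nonneg (neg_nonneg.2 h) hM, sq_nonneg (x * U), sq_nonneg (y * W)]
        nlinarith
    have := hmono (Set.left_mem_Icc.2 zero_le_one) (Set.right_mem_Icc.2 zero_le_one) zero_le_one
    simp only [g] at this
    rw [ha i, ha (i + 1), ha (i + 2)]
    push_cast
    simp only [add_zero] at this
    rw [show (i : ℝ) + 1 + 1 = i + 2 by ring] at *
    rw [show (i : ℝ) + 2 + 1 = i + 2 + 1 by ring] at *
    linarith
  have h := key (a (i + 1)) (a i)
  have h2 : 0 ≤ a i * (a i * a (i + 2) - a (i + 1) * a (i + 1)) := by nlinarith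
  have := nonneg_of_mul_nonneg_right h2 (hpos i)
  linarith

lemma aux_ratio (a : ℕ → ℝ) (hpos : ∀ i, 0 < a i)
    (hl : ∀ i, a (i + 1) * a (i + 1) ≤ a i * a (i + 2)) (m n : ℕ) (h : m ≤ n) :
    a (n + 1) * a (m + 1) ≤ a (n + 2) * a m := by
  induction n, h using Nat.le_induction with
  | base => have := hl m; linarith
  | succ n hmn ih =>
    have h1 := mul_le_mul_of_nonneg_left ih (hpos (n + 2)).le
    have h2 := mul_le_mul_of_nonneg_right (hl (n + 1)) (hpos m).le
    show a (n + 2) * a (m + 1) ≤ a (n + 3) * a m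
    have h3 : a (n + 1) * (a (n + 2) * a (m + 1)) ≤ a (n + 1) * (a (n + 3) * a m) := by
      have h2' : a (n + 2) * a (n + 2) * a m ≤ a (n + 1) * a (n + 3) * a m := h2
      linarith
    exact le_of_mul_le_mul_left h3 (hpos (n + 1))

lemma aux_antitone (a φ : ℕ → ℝ) (μ : ℝ) (hμ : 0 ≤ μ) (hpos : ∀ i, 0 < a i) (h0 : a 0 = 1)
    (hl : ∀ i, a (i + 1) * a (i + 1) ≤ a i * a (i + 2))
    (hS : ∀ n, ∑ k ∈ range (n + 1), a (n - k) * φ k = μ) (n : ℕ) :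
    φ (n + 1) - φ n ≤ 0 := by
  have hφ0 : φ 0 = μ := by simpa [h0] using hS 0
  have hb : ∀ n, a (n + 1) * μ + ∑ k ∈ range (n + 1), a (n - k) * (φ (k + 1) - φ k) = 0 := by
    intro n
    have h1 := hS (n + 1)
    rw [sum_range_succ'] at h1
    have h2 := hS n
    simp only [mul_sub, sum_sub_distrib, h2]
    simp only [Nat.add_sub_add_right, Nat.sub_zero, hφ0] at h1
    linarith
  induction n using Nat.strong_induction_on with
  | _ n ih =>
    rcases n with _ | n
    · have := hb 0
      simp [h0] at this
      have := mul_nonneg (hpos 1).le hμ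
      simp; linarith
    · have e1 := hb (n + 1)
      have e2 := hb n
      rw [sum_range_succ] at e1
      simp only [Nat.sub_self, h0, one_mul] at e1
      have hsum : ∑ k ∈ range (n + 1), (a (n + 2) * (a (n - k) * (φ (k + 1) - φ k))
          - a (n + 1) * (a (n + 1 - k) * (φ (k + 1) - φ k))) ≤ 0 := by
        apply sum_nonpos
        intro k hk
        have hk' : k ≤ n := by simpa [Nat.lt_succ_iff] using hk
        have hr := aux_ratio a hpos hl (n - k) n (Nat.sub_le _ _)
        rw [show n - k + 1 = n + 1 - k by omega] at hr
        have := ih k (by omega)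
        nlinarith
      rw [sum_sub_distrib, ← mul_sum, ← mul_sum] at hsum
      have : a (n + 1) * (φ (n + 1 + 1) - φ (n + 1)) ≤ 0 := by
        have e1' : φ (n + 1 + 1) - φ (n + 1) = -(a (n + 2) * μ)
          - ∑ k ∈ range (n + 1), a (n + 1 - k) * (φ (k + 1) - φ k) := by
          have : a (n + 1 + 1) = a (n + 2) := rfl
          linarith
        have e2' : ∑ k ∈ range (n + 1), a (n - k) * (φ (k + 1) - φ k) = -(a (n + 1) * μ) := by
          linarith
        rw [e1']
        rw [e2'] at hsum
        linarith
      exact nonpos_of_mul_nonpos_right this (hpos (n + 1))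

lemma aux_theta (α μ : ℝ) (hα0 : 0 < α) (hα1 : α < 1) (hμ : 0 ≤ μ) (a θ : ℕ → ℝ)
    (ha : ∀ i : ℕ, a i = ((i : ℝ) + 1) ^ (1 - α) - (i : ℝ) ^ (1 - α))
    (h0 : θ 0 = μ / a 0)
    (hθ : ∀ n : ℕ, 1 ≤ n →
          θ n = (a 0)⁻¹ * ∑ i ∈ Finset.Icc 1 n, (a (i - 1) - a i) * θ (n - i)) (n : ℕ) :
    θ n ≤ μ * ((n : ℝ) + 1) ^ (α - 1) := by
  have hp : 0 < 1 - α := by linarith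
  have hpos : ∀ i, 0 < a i := by
    intro i
    rw [ha, sub_pos]
    exact Real.rpow_lt_rpow (Nat.cast_nonneg i) (by linarith) hp
  have ha0 : a 0 = 1 := by
    rw [ha]; simp [Real.zero_rpow hp.ne']
  have hl := aux_logconvex (1 - α) hp (by linarith) a ha hpos
  have hrefl : ∀ n, ∑ k ∈ range (n + 1), a (n - k) * θ k = ∑ i ∈ range (n + 1), a i * θ (n - i) := by
    intro n
    rw [← sum_range_reflect]
    apply sum_congr rfl
    intro k hk
    have : k ≤ n := by simpa [Nat.lt_succ_iff] using hk
    rw [show n + 1 - 1 - k = n - k by omega, show n - (n - k) = k by omega]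
  have hS : ∀ n, ∑ k ∈ range (n + 1), a (n - k) * θ k = μ := by
    intro n
    induction n with
    | zero => simp [ha0, h0]
    | succ n ih =>
      rw [hrefl] at ih ⊢
      rw [sum_range_succ']
      have h1 := hθ (n + 1) (by omega)
      have h2 : ∑ i ∈ Finset.Icc 1 (n + 1), (a (i - 1) - a i) * θ (n + 1 - i)
          = ∑ i ∈ range (n + 1), (a i - a (i + 1)) * θ (n - i) := by
        rw [show Finset.Icc 1 (n + 1) = Finset.Ico 1 (n + 2) by ext; simp; omega,
          sum_Ico_eq_sum_range]
        apply sum_congr rfl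
        intro k _
        rw [show 1 + k - 1 = k by omega, show 1 + k = k + 1 by omega,
          show n + 1 - (k + 1) = n - k by omega]
      rw [h2, ha0] at h1
      simp only [sub_mul, sum_sub_distrib, ih] at h1
      simp only [Nat.add_sub_add_right, Nat.sub_zero, ha0]
      rw [h1]; ring
  have hanti : Antitone θ := antitone_nat_of_succ_le fun n => by
    have := aux_antitone a θ μ hμ hpos ha0 hl hS n
    linarith
  have hsuma : ∑ k ∈ range (n + 1), a k = ((n : ℝ) + 1) ^ (1 - α) := by
    have h := sum_range_sub (fun i : ℕ => (i : ℝ) ^ (1 - α)) (n + 1)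
    simp only [Nat.cast_add, Nat.cast_one, Nat.cast_zero, Real.zero_rpow hp.ne', sub_zero] at h
    rw [← h]
    exact sum_congr rfl fun i _ => ha i
  have hle : ((n : ℝ) + 1) ^ (1 - α) * θ n ≤ μ := by
    rw [← hsuma, sum_mul, ← hS n, hrefl]
    apply sum_le_sum
    intro i _
    exact mul_le_mul_of_nonneg_left (hanti (Nat.sub_le n i)) (hpos i).le
  have hn : (0 : ℝ) < (n : ℝ) + 1 := by positivity
  rw [show α - 1 = -(1 - α) by ring, Real.rpow_neg hn.le, ← div_eq_mul_inv,
    le_div_iff₀ (Real.rpow_pos_of_pos hn _)]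
  linarith

lemma aux_term (α σ : ℝ) (hα0 : 0 < α) (hα1 : α < 1) (hσ1 : 1 < σ) (hσ2 : σ ≤ 2)
    (x y n : ℝ) (hx : 1 ≤ x) (hy : 1 ≤ y) (hxy : x + y = n + 1) :
    x ^ (-σ) * y ^ (α - 1) ≤ 4 * n ^ (α - 1) * (x ^ (-σ) + y ^ (-σ)) := by
  have hn : 0 < n := by linarith
  have hx0 : 0 < x := by linarith
  have hy0 : 0 < y := by linarith
  have hN := Real.rpow_nonneg hn.le (α - 1)
  have hX := Real.rpow_nonneg hx0.le (-σ)
  have hY := Real.rpow_nonneg hy0.le (-σ)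
  have half : ∀ s : ℝ, s ≤ 2 → ∀ z, n / 2 ≤ z → 0 ≤ s → z ^ (-s) ≤ 4 * n ^ (-s) := by
    intro s hs z hz hs0
    calc z ^ (-s) ≤ (n / 2) ^ (-s) :=
          Real.rpow_le_rpow_of_nonpos (by positivity) hz (by linarith)
      _ = 2 ^ s * n ^ (-s) := by
          rw [Real.div_rpow hn.le (by norm_num), Real.rpow_neg (by norm_num : (0:ℝ) ≤ 2)]
          field_simp
      _ ≤ 4 * n ^ (-s) := by
          apply mul_le_mul_of_nonneg_right _ (Real.rpow_nonneg hn.le _)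
          calc (2 : ℝ) ^ s ≤ 2 ^ (2 : ℝ) := Real.rpow_le_rpow_of_exponent_le (by norm_num) hs
            _ = 4 := by norm_num
  rcases le_total (n / 2) y with h | h
  · have := half (1 - α) (by linarith) y h (by linarith)
    rw [neg_sub] at this
    have h1 := mul_le_mul_of_nonneg_left this hX
    have h2 := mul_nonneg hN hY
    nlinarith
  · have h3 := half σ hσ2 x (by linarith) (by linarith)
    have h4 : n ^ (-σ) * y ^ (α - 1) ≤ n ^ (α - 1) * y ^ (-σ) := by
      have e1 : n ^ (-σ) = n ^ (α - 1) * n ^ (-(σ + α - 1)) := by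
        rw [← Real.rpow_add hn]; congr 1; ring
      have e2 : y ^ (-σ) = y ^ (α - 1) * y ^ (-(σ + α - 1)) := by
        rw [← Real.rpow_add hy0]; congr 1; ring
      have h5 : n ^ (-(σ + α - 1)) ≤ y ^ (-(σ + α - 1)) :=
        Real.rpow_le_rpow_of_nonpos hy0 (by linarith) (by linarith)
      rw [e1, e2]
      have := mul_le_mul_of_nonneg_left h5 (mul_nonneg hN (Real.rpow_nonneg hy0.le (α - 1)))
      linarith
    have h6 := mul_le_mul_of_nonneg_right h3 (Real.rpow_nonneg hy0.le (α - 1))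
    have h7 := mul_nonneg hN hX
    nlinarith

/-- Discrete convolution of the L1 multipliers with the truncation error: if
`|r^i| ≤ C i^{-min(α+1, 2-α)}` for `1 ≤ i ≤ N`, then
`Σ_{i=1}^{n} |r^i| θ_{n-i} ≤ C' τ t_n^{α-1}` for `1 ≤ n ≤ N`, where `τ = T/N`,
`t_n = nτ`, and `C'` depends only on `C, α, T`. -/
theorem multipliers_truncation_convolution_bound
    (α T C : ℝ) (hα0 : 0 < α) (hα1 : α < 1) (hT : 0 < T) (hC : 0 ≤ C) :
    ∃ C' : ℝ, 0 < C' ∧ ∀ N : ℕ, 1 ≤ N →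
      ∀ (a θ r : ℕ → ℝ),
        (∀ i : ℕ, a i = ((i : ℝ) + 1) ^ (1 - α) - (i : ℝ) ^ (1 - α)) →
        θ 0 = (T / N) ^ α * Real.Gamma (2 - α) / a 0 →
        (∀ n : ℕ, 1 ≤ n →
          θ n = (a 0)⁻¹ * ∑ i ∈ Finset.Icc 1 n, (a (i - 1) - a i) * θ (n - i)) →
        (∀ i : ℕ, 1 ≤ i → i ≤ N → |r i| ≤ C * (i : ℝ) ^ (-min (α + 1) (2 - α))) →
        ∀ n : ℕ, 1 ≤ n → n ≤ N →
          (∑ i ∈ Finset.Icc 1 n, |r i| * θ (n - i))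
            ≤ C' * (T / N) * ((n : ℝ) * (T / N)) ^ (α - 1) := by
  set σ := min (α + 1) (2 - α) with hσ
  have hσ1 : 1 < σ := lt_min (by linarith) (by linarith)
  have hσ2 : σ ≤ 2 := (min_le_right _ _).trans (by linarith)
  have hsum : Summable fun i : ℕ => (i : ℝ) ^ (-σ) := Real.summable_nat_rpow.2 (by linarith)
  set Z := ∑' i : ℕ, (i : ℝ) ^ (-σ) with hZ
  have hnn : ∀ i : ℕ, (0 : ℝ) ≤ (i : ℝ) ^ (-σ) := fun i => Real.rpow_nonneg (Nat.cast_nonneg i) _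
  have hZ0 : 0 ≤ Z := tsum_nonneg hnn
  have hG : 0 < Real.Gamma (2 - α) := Real.Gamma_pos_of_pos (by linarith)
  refine ⟨8 * Z * C * Real.Gamma (2 - α) + 1, by positivity, ?_⟩
  intro N hN a θ r ha h0 hθ hr n hn1 hnN
  have hNpos : (0 : ℝ) < N := by exact_mod_cast hN
  have hτ : 0 < T / N := by positivity
  have hnpos : (0 : ℝ) < n := by exact_mod_cast hn1
  set τ := T / N
  have hμ : 0 ≤ τ ^ α * Real.Gamma (2 - α) := by positivity
  have hb := aux_theta α _ hα0 hα1 hμ a θ ha h0 hθ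
  set μ := τ ^ α * Real.Gamma (2 - α) with hμd
  have hterm : ∀ i ∈ Finset.Icc 1 n, |r i| * θ (n - i) ≤
      C * μ * (4 * (n : ℝ) ^ (α - 1)) * ((i : ℝ) ^ (-σ) + ((n + 1 - i : ℕ) : ℝ) ^ (-σ)) := by
    intro i hi
    rw [Finset.mem_Icc] at hi
    have hc : ((n + 1 - i : ℕ) : ℝ) = ((n - i : ℕ) : ℝ) + 1 := by
      rw [show n + 1 - i = n - i + 1 by omega]; push_cast; ring
    have hxy : (i : ℝ) + ((n + 1 - i : ℕ) : ℝ) = n + 1 := by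
      have : i + (n + 1 - i) = n + 1 := by omega
      exact_mod_cast this
    have ht := aux_term α σ hα0 hα1 hσ1 hσ2 i ((n + 1 - i : ℕ) : ℝ) n
      (by exact_mod_cast hi.1) (by exact_mod_cast (by omega : 1 ≤ n + 1 - i)) hxy
    have h1 := hb (n - i)
    rw [← hc] at h1
    calc |r i| * θ (n - i) ≤ |r i| * (μ * ((n + 1 - i : ℕ) : ℝ) ^ (α - 1)) :=
          mul_le_mul_of_nonneg_left h1 (abs_nonneg _)
      _ ≤ (C * (i : ℝ) ^ (-σ)) * (μ * ((n + 1 - i : ℕ) : ℝ) ^ (α - 1)) :=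
          mul_le_mul_of_nonneg_right (hr i hi.1 (by omega)) (by positivity)
      _ = C * μ * ((i : ℝ) ^ (-σ) * ((n + 1 - i : ℕ) : ℝ) ^ (α - 1)) := by ring
      _ ≤ C * μ * (4 * (n : ℝ) ^ (α - 1) * ((i : ℝ) ^ (-σ) + ((n + 1 - i : ℕ) : ℝ) ^ (-σ))) :=
          mul_le_mul_of_nonneg_left ht (by positivity)
      _ = _ := by ring
  have hs1 : ∑ i ∈ Finset.Icc 1 n, (i : ℝ) ^ (-σ) ≤ Z :=
    hsum.sum_le_tsum _ (fun i _ => hnn i)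
  have hs2 : ∑ i ∈ Finset.Icc 1 n, ((n + 1 - i : ℕ) : ℝ) ^ (-σ)
      = ∑ i ∈ Finset.Icc 1 n, (i : ℝ) ^ (-σ) := by
    apply Finset.sum_bij' (fun i _ => n + 1 - i) (fun i _ => n + 1 - i)
    all_goals intro i hi
    all_goals simp only [Finset.mem_Icc] at *
    all_goals try omega
  have hτα : τ * ((n : ℝ) * τ) ^ (α - 1) = τ ^ α * (n : ℝ) ^ (α - 1) := by
    rw [Real.mul_rpow hnpos.le hτ.le, Real.rpow_sub_one hτ.ne']
    field_simp
  have hP : 0 ≤ τ ^ α * (n : ℝ) ^ (α - 1) := by positivity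
  calc _ ≤ ∑ i ∈ Finset.Icc 1 n, C * μ * (4 * (n : ℝ) ^ (α - 1)) *
        ((i : ℝ) ^ (-σ) + ((n + 1 - i : ℕ) : ℝ) ^ (-σ)) := Finset.sum_le_sum hterm
    _ = C * μ * (4 * (n : ℝ) ^ (α - 1)) * (2 * ∑ i ∈ Finset.Icc 1 n, (i : ℝ) ^ (-σ)) := by
        rw [← Finset.mul_sum, Finset.sum_add_distrib, hs2]; ring
    _ ≤ C * μ * (4 * (n : ℝ) ^ (α - 1)) * (2 * Z) :=
        mul_le_mul_of_nonneg_left (by linarith) (by positivity)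
    _ = 8 * Z * C * Real.Gamma (2 - α) * (τ ^ α * (n : ℝ) ^ (α - 1)) := by rw [hμd]; ring
    _ ≤ (8 * Z * C * Real.Gamma (2 - α) + 1) * (τ ^ α * (n : ℝ) ^ (α - 1)) := by linarith
    _ = _ := by rw [← hτα]; ring
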